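/- Let I ⊆ S be finitary. The assignment (x,J) ↦ (J, W_I·x·W_J) is a bijection from the set of pairs (x,J), with J ⊆ S and x ∈ W satisfying W_I·x = x·W_J and ℓ(x) ≤ ℓ(x·y) for all y ∈ W_J, onto the set of pairs (J,p) where J ⊆ S is finitary and p is a core (I,J)-coset. -/

import Mathlib

namespace CoxeterAtoms

variable {B : Type*} {W : Type*} [Group W] {M : CoxeterMatrix B}

/-- The standard parabolic subgroup `W_K` generated by the simple reflections indexed by `K`. -/
def par (cs : CoxeterSystem M W) (K : Set B) : Subgroup W :=
  Subgroup.closure (cs.simple '' K)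

/-- `K` is finitary if `W_K` is finite. -/
def Finitary (cs : CoxeterSystem M W) (K : Set B) : Prop :=
  ((par cs K : Set W)).Finite

/-- The left coset `W_I · x`. -/
def lcos (cs : CoxeterSystem M W) (I : Set B) (x : W) : Set W :=
  {w | ∃ a ∈ par cs I, w = a * x}

/-- The right coset `x · W_J`. -/
def rcos (cs : CoxeterSystem M W) (x : W) (J : Set B) : Set W :=
  {w | ∃ b ∈ par cs J, w = x * b}

/-- The double coset `W_I · x · W_J`. -/
def dcos (cs : CoxeterSystem M W) (I : Set B) (x : W) (J : Set B) : Set W :=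
  {w | ∃ a ∈ par cs I, ∃ b ∈ par cs J, w = a * x * b}

/-- `x` is a minimal length element of its double coset `W_I · x · W_J`. -/
def IsMinRep (cs : CoxeterSystem M W) (I : Set B) (x : W) (J : Set B) : Prop :=
  ∀ w ∈ dcos cs I x J, cs.length x ≤ cs.length w

/-- `y` is a maximal length element of the set `p`. -/
def IsMaxOf (cs : CoxeterSystem M W) (p : Set W) (y : W) : Prop :=
  y ∈ p ∧ ∀ w ∈ p, cs.length w ≤ cs.length y

/-- `y` is the longest element of the standard parabolic subgroup `W_K`. -/
def IsLongest (cs : CoxeterSystem M W) (K : Set B) (y : W) : Prop :=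
  y ∈ par cs K ∧ ∀ w ∈ par cs K, cs.length w ≤ cs.length y

/-- The double coset `W_I · x · W_J` is core: `W_I·x = W_I·x·W_J = x·W_J`. -/
def IsCore (cs : CoxeterSystem M W) (I : Set B) (x : W) (J : Set B) : Prop :=
  lcos cs I x = dcos cs I x J ∧ dcos cs I x J = rcos cs x J

open Classical in
/-- The action of a simple reflection on `W × ZMod 2`. -/
noncomputable def sig (cs : CoxeterSystem M W) (i : B) : Function.End (W × ZMod 2) :=
  fun p => (cs.simple i * p.1 * cs.simple i, p.2 + if p.1 = cs.simple i then 1 else 0)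

theorem pow_comm_simple (cs : CoxeterSystem M W) (i j : B) (l : ℕ) :
    (cs.simple i * cs.simple j) ^ l * cs.simple j * (cs.simple i * cs.simple j) ^ l
      = cs.simple j := by
  induction l with
  | zero => simp
  | succ l ih =>
    rw [pow_succ]
    nth_rw 2 [← pow_succ]
    rw [pow_succ']
    calc _ = (cs.simple i * cs.simple j) ^ l * (cs.simple i * (cs.simple j * cs.simple j)
              * cs.simple i * cs.simple j) * (cs.simple i * cs.simple j) ^ l := by
            simp only [mul_assoc]
      _ = _ := by simp [ih]

open Classical in
theorem sig_pow (cs : CoxeterSystem M W) (i j : B) (k : ℕ) (p : W × ZMod 2) :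
    ((sig cs i * sig cs j) ^ k) p =
      ((cs.simple i * cs.simple j) ^ k * p.1 * ((cs.simple i * cs.simple j) ^ k)⁻¹,
        p.2 + ∑ n ∈ Finset.range (2 * k),
          if p.1 = cs.simple j * (cs.simple i * cs.simple j) ^ n then 1 else 0) := by
  induction k with
  | zero => simp; rfl
  | succ k ih =>
    rw [pow_succ']
    change sig cs i (sig cs j (((sig cs i * sig cs j) ^ k) p)) = _
    rw [ih]
    have h := pow_comm_simple cs i j k
    set r := cs.simple i * cs.simple j with hr
    have hji : r⁻¹ = cs.simple j * cs.simple i := by simp [hr]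
    have e1 : (r ^ k * p.1 * (r ^ k)⁻¹ = cs.simple j) ↔ p.1 = cs.simple j * r ^ (2 * k) := by
      rw [mul_inv_eq_iff_eq_mul, ← eq_inv_mul_iff_mul_eq, two_mul, pow_add]
      have : (r ^ k)⁻¹ * (cs.simple j * r ^ k) = cs.simple j * (r ^ k * r ^ k) := by
        rw [inv_mul_eq_iff_eq_mul]
        nth_rw 1 [← h]
        simp only [mul_assoc]
      rw [this]
    have e2 : (cs.simple j * (r ^ k * p.1 * (r ^ k)⁻¹) * cs.simple j = cs.simple i) ↔
        p.1 = cs.simple j * r ^ (2 * k + 1) := by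
      have a1 : (cs.simple j * (r ^ k * p.1 * (r ^ k)⁻¹) * cs.simple j = cs.simple i) ↔
          r ^ k * p.1 * (r ^ k)⁻¹ = cs.simple j * r := by
        constructor
        · intro h'
          generalize r ^ k * p.1 * (r ^ k)⁻¹ = q at h' ⊢
          rw [hr, ← h']
          simp [mul_assoc]
        · intro h'
          rw [h', hr]
          simp [mul_assoc]
      rw [a1, mul_inv_eq_iff_eq_mul, ← eq_inv_mul_iff_mul_eq]
      have : (r ^ k)⁻¹ * (cs.simple j * r * r ^ k) = cs.simple j * r ^ (2 * k + 1) := by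
        rw [inv_mul_eq_iff_eq_mul, mul_assoc, ← pow_succ', ← mul_assoc,
          show 2 * k + 1 = k + (k + 1) by omega, pow_add _ k (k + 1), ← mul_assoc, h]
      rw [this]
    simp only [sig]
    rw [show 2 * (k + 1) = 2 * k + 1 + 1 by ring, Finset.sum_range_succ, Finset.sum_range_succ]
    simp only [e1, e2]
    ext1
    · simp only [pow_succ', mul_inv_rev, hji]
      simp only [hr, mul_assoc]
    · simp only [add_assoc]

theorem sig_liftable (cs : CoxeterSystem M W) : M.IsLiftable (sig cs) := by
  classical
  intro i j
  funext p
  rw [sig_pow, cs.simple_mul_simple_pow]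
  have : (∑ n ∈ Finset.range (2 * M i j),
      if p.1 = cs.simple j * (cs.simple i * cs.simple j) ^ n then (1 : ZMod 2) else 0) = 0 := by
    rw [two_mul, Finset.sum_range_add]
    simp only [pow_add, cs.simple_mul_simple_pow, one_mul]
    exact CharTwo.add_self_eq_zero _
  rw [this]
  simp
  rfl

open Classical in
theorem lift_sig (cs : CoxeterSystem M W) (ω : List B) (p : W × ZMod 2) :
    (cs.lift ⟨sig cs, sig_liftable cs⟩ (cs.wordProd ω)) p =
      (cs.wordProd ω * p.1 * (cs.wordProd ω)⁻¹,
        p.2 + ((cs.rightInvSeq ω).count p.1 : ZMod 2)) := by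
  induction ω with
  | nil => simp; rfl
  | cons i ω ih =>
    rw [cs.wordProd_cons, map_mul, cs.lift_apply_simple]
    change sig cs i (cs.lift ⟨sig cs, sig_liftable cs⟩ (cs.wordProd ω) p) = _
    rw [ih]
    simp only [sig, CoxeterSystem.rightInvSeq, List.count_cons]
    ext1
    · simp [mul_assoc]
    · have : (cs.wordProd ω * p.1 * (cs.wordProd ω)⁻¹ = cs.simple i) ↔
          ((cs.wordProd ω)⁻¹ * cs.simple i * cs.wordProd ω = p.1) := by
        constructor
        · intro h; rw [← h]; group
        · intro h; rw [← h]; group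
      simp only [this, beq_iff_eq]
      push_cast
      rw [add_assoc]

/-- The exchange property. -/
theorem exchange (cs : CoxeterSystem M W) (ω : List B) (i : B)
    (h : cs.length (cs.wordProd ω * cs.simple i) < cs.length (cs.wordProd ω)) :
    ∃ k < ω.length, cs.wordProd ω * cs.simple i = cs.wordProd (ω.eraseIdx k) := by
  classical
  obtain ⟨ν, hν, hw⟩ := cs.exists_isReduced (cs.wordProd ω * cs.simple i)
  have hp : cs.wordProd (ν.concat i) = cs.wordProd ω := by
    rw [cs.wordProd_concat, ← hw]; simp
  have hred : cs.IsReduced (ν.concat i) := by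
    have h1 := cs.length_mul_simple (cs.wordProd ω) i
    have h2 := hν.eq
    rw [← hw] at h2
    unfold CoxeterSystem.IsReduced
    rw [hp, List.length_concat]
    omega
  have hmem : cs.simple i ∈ cs.rightInvSeq (ν.concat i) := by
    rw [cs.rightInvSeq_concat]; simp
  have hc := List.count_eq_one_of_mem (CoxeterSystem.IsReduced.nodup_rightInvSeq cs hred) hmem
  have e1 := lift_sig cs (ν.concat i) (cs.simple i, 0)
  rw [hp, lift_sig cs ω] at e1
  have e2 := congrArg Prod.snd e1
  simp only [hc] at e2
  have hm : cs.simple i ∈ cs.rightInvSeq ω := by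
    by_contra hn
    rw [List.count_eq_zero_of_not_mem hn] at e2
    simp at e2
  obtain ⟨k, hk, hk'⟩ := List.mem_iff_getElem.mp hm
  refine ⟨k, by simpa using hk, ?_⟩
  rw [← cs.wordProd_mul_getD_rightInvSeq, List.getD_eq_getElem _ _ hk, hk']

theorem wordProd_mem_par (cs : CoxeterSystem M W) (J : Set B) (ω : List B) (h : ∀ i ∈ ω, i ∈ J) :
    cs.wordProd ω ∈ par cs J := by
  induction ω with
  | nil => simp [one_mem]
  | cons i ω ih =>
    rw [cs.wordProd_cons]
    exact mul_mem (Subgroup.subset_closure ⟨i, h i (by simp), rfl⟩)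
      (ih fun j hj => h j (by simp [hj]))

theorem step (cs : CoxeterSystem M W) (J : Set B) (x : W)
    (hx : ∀ y ∈ par cs J, cs.length x ≤ cs.length (x * y)) (b : W) (i : B) (hi : i ∈ J)
    (hb : ∃ ω : List B, (∀ i ∈ ω, i ∈ J) ∧ cs.wordProd ω = b ∧
      cs.length (x * b) = cs.length x + ω.length) :
    ∃ ω : List B, (∀ i ∈ ω, i ∈ J) ∧ cs.wordProd ω = b * cs.simple i ∧
      cs.length (x * (b * cs.simple i)) = cs.length x + ω.length := by
  obtain ⟨ω, hω, rfl, hl⟩ := hb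
  have h1 := cs.length_mul_simple (x * cs.wordProd ω) i
  rw [mul_assoc] at h1
  rcases h1 with h1 | h1
  · refine ⟨ω.concat i, ?_, cs.wordProd_concat i ω, ?_⟩
    · intro j hj
      simp only [List.concat_eq_append, List.mem_append, List.mem_singleton] at hj
      rcases hj with hj | rfl
      · exact hω j hj
      · exact hi
    · rw [h1, hl, List.length_concat]; omega
  · obtain ⟨ν, hν, hxν⟩ := cs.exists_isReduced x
    obtain ⟨k, hk, hk'⟩ := exchange cs (ν ++ ω) i (by
      rw [cs.wordProd_append, ← hxν, mul_assoc]; omega)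
    rw [cs.wordProd_append, ← hxν, mul_assoc] at hk'
    have hνl : cs.length x = ν.length := by rw [hxν]; exact hν.eq
    rw [List.length_append] at hk
    by_cases hkν : k < ν.length
    · exfalso
      rw [List.eraseIdx_append_of_lt_length hkν, cs.wordProd_append] at hk'
      have hm := wordProd_mem_par cs J ω hω
      have hs : cs.simple i ∈ par cs J := Subgroup.subset_closure ⟨i, hi, rfl⟩
      have h2 := hx _ (mul_mem (mul_mem hm hs) (inv_mem hm))
      rw [← mul_assoc, hk', mul_inv_cancel_right] at h2
      have h3 := cs.length_wordProd_le (ν.eraseIdx k)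
      have h4 := List.length_eraseIdx_add_one hkν
      omega
    · rw [List.eraseIdx_append_of_length_le (by omega), cs.wordProd_append, ← hxν] at hk'
      refine ⟨ω.eraseIdx (k - ν.length), ?_, (mul_left_cancel hk').symm, ?_⟩
      · intro j hj
        exact hω j (List.mem_of_mem_eraseIdx hj)
      · have h4 := List.length_eraseIdx_add_one (l := ω) (i := k - ν.length) (by omega)
        omega

theorem min_word (cs : CoxeterSystem M W) (J : Set B) (x : W)
    (hx : ∀ y ∈ par cs J, cs.length x ≤ cs.length (x * y)) (b : W) (hb : b ∈ par cs J) :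
    ∃ ω : List B, (∀ i ∈ ω, i ∈ J) ∧ cs.wordProd ω = b ∧
      cs.length (x * b) = cs.length x + ω.length := by
  unfold par at hb
  induction hb using Subgroup.closure_induction_right with
  | one => exact ⟨[], by simp, by simp, by simp⟩
  | mul_right b hb y hy ih =>
    obtain ⟨i, hi, rfl⟩ := hy
    exact step cs J x hx b i hi ih
  | mul_inv_cancel b hb y hy ih =>
    obtain ⟨i, hi, rfl⟩ := hy
    rw [cs.inv_simple]
    exact step cs J x hx b i hi ih

theorem min_unique (cs : CoxeterSystem M W) (J : Set B) (x b : W)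
    (hx : ∀ y ∈ par cs J, cs.length x ≤ cs.length (x * y)) (hb : b ∈ par cs J)
    (hl : cs.length (x * b) ≤ cs.length x) : b = 1 := by
  obtain ⟨ω, -, rfl, h⟩ := min_word cs J x hx b hb
  have : ω = [] := List.length_eq_zero_iff.mp (by omega)
  simp [this]

theorem dcos_eq (cs : CoxeterSystem M W) (I J : Set B) (x : W)
    (h : lcos cs I x = rcos cs x J) : dcos cs I x J = rcos cs x J := by
  ext w
  constructor
  · rintro ⟨a, ha, b, hb, rfl⟩
    have : a * x ∈ rcos cs x J := h ▸ ⟨a, ha, rfl⟩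
    obtain ⟨c, hc, hc'⟩ := this
    exact ⟨c * b, mul_mem hc hb, by rw [hc', mul_assoc]⟩
  · rintro ⟨b, hb, rfl⟩
    exact ⟨1, one_mem _, b, hb, by simp⟩

theorem statement_11 (cs : CoxeterSystem M W) (I : Set B) (hI : Finitary cs I) :
    Set.BijOn (fun xJ : W × Set B => (xJ.2, dcos cs I xJ.1 xJ.2))
      {xJ : W × Set B | lcos cs I xJ.1 = rcos cs xJ.1 xJ.2 ∧
        ∀ y ∈ par cs xJ.2, cs.length xJ.1 ≤ cs.length (xJ.1 * y)}
      {Jp : Set B × Set W | Finitary cs Jp.1 ∧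
        ∃ x : W, Jp.2 = dcos cs I x Jp.1 ∧ IsCore cs I x Jp.1} := by
  refine ⟨?_, ?_, ?_⟩
  · rintro ⟨x, J⟩ ⟨h, -⟩
    dsimp only at h
    refine ⟨?_, x, rfl, ?_, ?_⟩
    · have h1 : (lcos cs I x).Finite := by
        refine (hI.image (fun a => a * x)).subset ?_
        rintro _ ⟨a, ha, rfl⟩
        exact ⟨a, ha, rfl⟩
      rw [h] at h1
      refine (h1.image (fun a => x⁻¹ * a)).subset ?_
      intro b hb
      exact ⟨x * b, ⟨b, hb, rfl⟩, by simp⟩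
    · exact h.trans (dcos_eq cs I J x h).symm
    · exact dcos_eq cs I J x h
  · rintro ⟨x, J⟩ ⟨h, hx⟩ ⟨x', J'⟩ ⟨h', hx'⟩ he
    dsimp only at h hx h' hx' he
    obtain ⟨rfl, he⟩ := Prod.mk.inj he
    rw [dcos_eq cs I J x h, dcos_eq cs I J x' h'] at he
    have hm : x' ∈ rcos cs x J := he ▸ ⟨1, one_mem _, by simp⟩
    obtain ⟨b, hb, rfl⟩ := hm
    have := hx' b⁻¹ (inv_mem hb)
    rw [mul_inv_cancel_right] at this
    rw [min_unique cs J x b hx hb this, mul_one]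
  · rintro ⟨J, p⟩ ⟨hJ, x, hp, hc1, hc2⟩
    dsimp only at hJ hp hc1 hc2
    obtain ⟨b, hb, hmin⟩ := Set.exists_min_image (par cs J : Set W)
      (fun b => cs.length (x * b)) hJ ⟨1, one_mem _⟩
    have hb' : b ∈ par cs J := hb
    refine ⟨(x * b, J), ⟨?_, ?_⟩, ?_⟩
    · change lcos cs I (x * b) = rcos cs (x * b) J
      have h := hc1.trans hc2
      ext w
      constructor
      · rintro ⟨a, ha, rfl⟩
        have : a * x ∈ rcos cs x J := h ▸ ⟨a, ha, rfl⟩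
        obtain ⟨c, hc, hc'⟩ := this
        exact ⟨b⁻¹ * c * b, mul_mem (mul_mem (inv_mem hb') hc) hb', by
          rw [← mul_assoc a, hc']; group⟩
      · rintro ⟨c, hc, rfl⟩
        have : x * (b * c * b⁻¹) ∈ lcos cs I x :=
          h ▸ ⟨_, mul_mem (mul_mem hb' hc) (inv_mem hb'), rfl⟩
        obtain ⟨a, ha, ha'⟩ := this
        exact ⟨a, ha, by rw [← mul_assoc a, ← ha']; group⟩
    · intro y hy
      change cs.length (x * b) ≤ cs.length (x * b * y)
      rw [mul_assoc]
      exact hmin (b * y) (mul_mem hb' hy)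
    · change (J, dcos cs I (x * b) J) = (J, p)
      rw [hp]
      congr 1
      ext w
      constructor
      · rintro ⟨a, ha, c, hc, rfl⟩
        exact ⟨a, ha, b * c, mul_mem hb' hc, by simp only [mul_assoc]⟩
      · rintro ⟨a, ha, c, hc, rfl⟩
        exact ⟨a, ha, b⁻¹ * c, mul_mem (inv_mem hb') hc, by group⟩

end CoxeterAtoms
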